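/- For every real number M, the set of outer automorphism classes [Φ] ∈ Out(F) with L(Φ) < M is finite. Consequently, for any sequence (Φ_n) of automorphisms of F, after passing to a subsequence there exist v_n ∈ F such that the automorphisms Ψ_n : x ↦ v_n Φ_n(x) v_n⁻¹ either form a constant sequence or satisfy L(Φ_n) → ∞, and exactly one of these alternatives holds. -/

import Mathlib

open MeasureTheory Filter Topology
open scoped ENNReal NNReal

namespace FGC

noncomputable section

variable (k : ℕ)

/-- The alphabet `A = Σ ∪ Σ⁻¹`: a letter is a basis element together with a sign. -/
abbrev L := Fin k × Bool

/-- The inverse of a letter. -/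
def linv (a : L k) : L k := (a.1, !a.2)

/-- A right-infinite word is (freely) reduced if no letter is followed by its inverse. -/
def Red (x : ℕ → L k) : Prop := ∀ n, x (n + 1) ≠ linv k (x n)

/-- The boundary `∂F`: the set of infinite freely reduced words in the alphabet `A`. -/
def Boundary : Type := { x : ℕ → L k // Red k x }

instance : TopologicalSpace (Boundary k) :=
  inferInstanceAs (TopologicalSpace { x : ℕ → L k // Red k x })

instance : MeasurableSpace (Boundary k) := borel _

instance : BorelSpace (Boundary k) := ⟨rfl⟩

/-- The free group of rank `k`. -/
abbrev F := FreeGroup (Fin k)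

/-- The word length `|v|` of an element of `F`. -/
def wordLength (v : F k) : ℕ := v.toWord.length

/-- The cyclically reduced length `‖v‖`: the minimal word length among conjugates of `v`. -/
def cyclLength (v : F k) : ℕ := sInf { n | ∃ g : F k, wordLength k (g * v * g⁻¹) = n }

/-- The cylinder `Cyl v ⊆ ∂F` of rays starting with the reduced word of `v`. -/
def Cyl (v : F k) : Set (Boundary k) :=
  { x | ∀ i : Fin v.toWord.length, x.1 i = v.toWord.get i }

/-- The shift deleting the first letter of a ray. -/
def shift (x : ℕ → L k) : ℕ → L k := fun n => x (n + 1)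

/-- Prepending a letter to a ray. -/
def cons (a : L k) (x : ℕ → L k) : ℕ → L k
  | 0 => a
  | n + 1 => x n

/-- Prepending a (reversed) finite word to a ray, performing free reduction. -/
def prependAux : List (L k) → (ℕ → L k) → ℕ → L k
  | [], x => x
  | a :: r, x => prependAux r (if x 0 = linv k a then shift k x else cons k a x)

theorem red_shift {x : ℕ → L k} (hx : Red k x) : Red k (shift k x) :=
  fun n => hx (n + 1)

theorem red_cons {a : L k} {x : ℕ → L k} (hx : Red k x) (h : x 0 ≠ linv k a) :
    Red k (cons k a x) := by
  intro n
  cases n with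
  | zero => exact h
  | succ m => exact hx m

theorem red_prependAux : ∀ (r : List (L k)) {x : ℕ → L k}, Red k x → Red k (prependAux k r x)
  | [], _, hx => hx
  | a :: r, x, hx => by
    by_cases h : x 0 = linv k a
    · simp only [prependAux, if_pos h]
      exact red_prependAux r (red_shift k hx)
    · simp only [prependAux, if_neg h]
      exact red_prependAux r (red_cons k hx h)

/-- The left-translation action of `F` on `∂F`: concatenate and freely reduce. -/
def act (g : F k) (x : Boundary k) : Boundary k :=
  ⟨prependAux k g.toWord.reverse x.1, red_prependAux k _ x.2⟩

/-- The shift map `T : ∂F → ∂F`. -/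
def Tmap (x : Boundary k) : Boundary k := ⟨shift k x.1, red_shift k x.2⟩

/-- The double boundary `∂²F`, as the complement of the diagonal. -/
def D2 : Set (Boundary k × Boundary k) := { p | p.1 ≠ p.2 }

/-- The diagonal action of `F` on `∂F × ∂F`. -/
def actPair (g : F k) (p : Boundary k × Boundary k) : Boundary k × Boundary k :=
  (act k g p.1, act k g p.2)

/-- The cylinder `Cyl[1,w]` of geodesics through the segment from `1` to `w`. -/
def baseCyl (w : F k) : Set (Boundary k × Boundary k) :=
  { p | p.1.1 0 ≠ p.2.1 0 ∧ p.2 ∈ Cyl k w }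

/-- The base-ball `B = Cyl[1,1]` of geodesics through the base point. -/
def baseBall : Set (Boundary k × Boundary k) := baseCyl k 1

/-- The cylinder `Cyl[x,y] = x · Cyl[1, x⁻¹y]`. -/
def Cyl2 (x y : F k) : Set (Boundary k × Boundary k) :=
  actPair k x '' baseCyl k (x⁻¹ * y)

/-- A geodesic current: a Borel measure on `∂F × ∂F` giving no mass to the diagonal,
invariant under the diagonal `F`-action, and finite on compact subsets of `∂²F`. -/
def IsCurrent (η : Measure (Boundary k × Boundary k)) : Prop :=
  η { p | p.1 = p.2 } = 0 ∧
  (∀ g : F k, ∀ W : Set (Boundary k × Boundary k), MeasurableSet W →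
    η (actPair k g ⁻¹' W) = η W) ∧
  (∀ K : Set (Boundary k × Boundary k), K ⊆ D2 k → IsCompact K → η K < ⊤)

/-- The element of `F` given by the first `n` letters of a ray. -/
def prefixEl (x : Boundary k) (n : ℕ) : F k :=
  FreeGroup.mk (List.ofFn fun i : Fin n => x.1 i)

/-- `b : ∂F → ∂F` is the boundary extension of the automorphism `Φ`: for every ray `x`
and every `m`, the length-`m` prefix of `b x` is the length-`m` prefix of the reduced
word of `Φ (x|_n)` for all sufficiently large `n`. -/
def IsBdryExt (Φ : F k ≃* F k) (b : Boundary k → Boundary k) : Prop :=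
  ∀ x : Boundary k, ∀ m : ℕ, ∃ N : ℕ, ∀ n ≥ N,
    (Φ (prefixEl k x n)).toWord.take m = List.ofFn fun i : Fin m => (b x).1 i

/-- The map `∂Φ × ∂Φ` on pairs. -/
def pairMap (b : Boundary k → Boundary k) (p : Boundary k × Boundary k) :
    Boundary k × Boundary k := (b p.1, b p.2)

/-- The length of an automorphism with boundary map `b`, w.r.t. the current `η`:
`L(Φ) = η((∂Φ × ∂Φ)⁻¹ B)`. -/
def autLen (η : Measure (Boundary k × Boundary k)) (b : Boundary k → Boundary k) : ℝ≥0∞ :=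
  η (pairMap k b ⁻¹' baseBall k)

/-- The subgroup of inner automorphisms. -/
abbrev Inn : Subgroup (MulAut (F k)) := (MulAut.conj : F k →* MulAut (F k)).range

/-- `Out(F) = Aut(F)/Inn(F)` as a coset space. -/
abbrev OutQ := MulAut (F k) ⧸ Inn k

/-- A simple automorphism: induced by a permutation of the basis, or inner. -/
def SimpleAut (Φ : MulAut (F k)) : Prop :=
  (∃ σ : Equiv.Perm (Fin k), ∀ i, Φ (FreeGroup.of i) = FreeGroup.of (σ i)) ∨
  (∃ v : F k, ∀ x, Φ x = v * x * v⁻¹)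

/-- A Whitehead automorphism of the second kind. -/
def Whitehead2 (τ : MulAut (F k)) : Prop :=
  ∃ a : Fin k, ∀ i : Fin k,
    τ (FreeGroup.of i) = FreeGroup.of i ∨
    τ (FreeGroup.of i) = FreeGroup.of i * FreeGroup.of a ∨
    τ (FreeGroup.of i) = (FreeGroup.of a)⁻¹ * FreeGroup.of i ∨
    τ (FreeGroup.of i) = (FreeGroup.of a)⁻¹ * FreeGroup.of i * FreeGroup.of a

/-- The space of frequency measures: finite `T`-invariant Borel measures on `∂F`. -/
def FreqM : Type :=
  { μ : Measure (Boundary k) //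
    IsFiniteMeasure μ ∧ ∀ W : Set (Boundary k), MeasurableSet W → μ (Tmap k ⁻¹' W) = μ W }

/-- The space of geodesic currents. -/
def Currents : Type := { η : Measure (Boundary k × Boundary k) // IsCurrent k η }

/-- Continuous functions on `∂F × ∂F` with compact support contained in `∂²F`;
these are the test functions for the weak-* topology on currents. -/
def TestF : Type :=
  { φ : Boundary k × Boundary k → ℝ //
    Continuous φ ∧ IsCompact (tsupport φ) ∧ tsupport φ ⊆ D2 k }

/-- The weak-* topology on frequency measures. -/
instance : TopologicalSpace (FreqM k) :=
  ⨅ φ : C(Boundary k, ℝ),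
    TopologicalSpace.induced (fun μ : FreqM k => ∫ x, φ x ∂μ.1) inferInstance

/-- The weak-* topology on geodesic currents. -/
instance : TopologicalSpace (Currents k) :=
  ⨅ φ : TestF k,
    TopologicalSpace.induced (fun η : Currents k => ∫ p, φ.1 p ∂η.1) inferInstance

/-- Convergence of a sequence of group elements (as reduced words) to a boundary ray. -/
def WordTendsto (pn : ℕ → F k) (p : Boundary k) : Prop :=
  ∀ m : ℕ, ∃ N : ℕ, ∀ n ≥ N, (pn n).toWord.take m = List.ofFn fun i : Fin m => p.1 i

/-- The length of the maximal common initial segment of two rays. -/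
def commonLen (p : Boundary k × Boundary k) : ℕ :=
  sSup { m : ℕ | ∀ i < m, p.1.1 i = p.2.1 i }

/-- A single letter as an element of `F`. -/
def el (a : L k) : F k := FreeGroup.mk [a]

/-- The product of per-letter constants over the reduced word of `w`. -/
def Cprod (C : L k → ℝ≥0) (w : F k) : ℝ≥0 := (w.toWord.map C).prod

/-! ### Letters and the translation action -/

section Letters

variable {k : ℕ}

@[simp] theorem linv_linv (a : L k) : linv k (linv k a) = a := by
  simp [linv]

theorem el_inv (a : L k) : (el k a)⁻¹ = el k (linv k a) := by
  simp [el, linv, FreeGroup.inv_mk, FreeGroup.invRev]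

theorem el_toWord (a : L k) : (el k a).toWord = [a] := by
  simp [el, FreeGroup.toWord_mk]

theorem mk_cons (a : L k) (w : List (L k)) :
    (FreeGroup.mk (a :: w) : F k) = el k a * FreeGroup.mk w := by
  simp [el]

/-- Induction over the free group by left multiplication with letters. -/
theorem el_induction {P : F k → Prop} (h1 : P 1) (hmul : ∀ a g, P g → P (el k a * g)) (g : F k) :
    P g := by
  rw [← FreeGroup.mk_toWord (x := g)]
  induction g.toWord with
  | nil => exact h1
  | cons a w ih => rw [mk_cons]; exact hmul a _ ih

theorem Boundary.ext {x y : Boundary k} (h : ∀ n, x.1 n = y.1 n) : x = y :=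
  Subtype.ext (funext h)

/-- Left translation of a ray by a letter. -/
def step (a : L k) (x : Boundary k) : Boundary k :=
  ⟨if x.1 0 = linv k a then shift k x.1 else cons k a x.1, by
    split_ifs with h
    · exact red_shift k x.2
    · exact red_cons k x.2 h⟩

theorem step_of_eq {a : L k} {x : Boundary k} (h : x.1 0 = linv k a) :
    step a x = Tmap k x := Subtype.ext (if_pos h)

theorem step_of_ne {a : L k} {x : Boundary k} (h : x.1 0 ≠ linv k a) :
    (step a x).1 = cons k a x.1 := if_neg h

theorem step_head (a : L k) (x : Boundary k) : (step a x).1 0 = a ↔ x.1 0 ≠ linv k a := by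
  by_cases h : x.1 0 = linv k a
  · rw [step_of_eq h]
    have := x.2 0
    simp only [h, linv_linv] at this
    simpa [h, Tmap, shift] using this
  · simp [step_of_ne h, h, cons]

theorem step_linv_step (a : L k) (x : Boundary k) : step (linv k a) (step a x) = x := by
  by_cases h : x.1 0 = linv k a
  · have h1 : (step a x).1 0 ≠ linv k (linv k a) := by
      rw [linv_linv, ne_eq, step_head, not_not, h]
    apply Boundary.ext
    intro n
    rw [step_of_ne h1, step_of_eq h]
    cases n with
    | zero => exact h.symm
    | succ n => rfl
  · have h1 : (step a x).1 0 = linv k (linv k a) := by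
      rw [linv_linv, step_head]; exact h
    rw [step_of_eq h1]
    apply Boundary.ext
    intro n
    simp [Tmap, shift, step_of_ne h, cons]

/-- Translation by a letter as a permutation of the boundary. -/
def stepEquiv (a : L k) : Equiv.Perm (Boundary k) where
  toFun := step a
  invFun := step (linv k a)
  left_inv := step_linv_step a
  right_inv x := by simpa using step_linv_step (linv k a) x

/-- The translation action as a homomorphism. -/
def actHom : F k →* Equiv.Perm (Boundary k) :=
  FreeGroup.lift fun i => stepEquiv (i, true)

theorem actHom_mk (w : List (L k)) : actHom (FreeGroup.mk w) = (w.map stepEquiv).prod := by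
  rw [actHom, FreeGroup.lift_mk]
  congr 1
  apply List.map_congr_left
  rintro ⟨i, b⟩ -
  cases b
  · apply Equiv.ext; intro x; rfl
  · rfl

theorem prependAux_eq (r : List (L k)) (x : Boundary k) :
    prependAux k r x.1 = ((r.reverse.map stepEquiv).prod x).1 := by
  induction r generalizing x with
  | nil => rfl
  | cons a r ih =>
    rw [prependAux]
    refine (ih (step a x)).trans ?_
    simp [stepEquiv, Equiv.Perm.mul_apply]

theorem act_eq_actHom (g : F k) (x : Boundary k) : act k g x = actHom g x := by
  apply Subtype.ext
  refine (prependAux_eq _ x).trans ?_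
  rw [List.reverse_reverse, ← actHom_mk, FreeGroup.mk_toWord]

theorem act_mul (g h : F k) (x : Boundary k) : act k (g * h) x = act k g (act k h x) := by
  simp [act_eq_actHom, Equiv.Perm.mul_apply]

@[simp] theorem act_one (x : Boundary k) : act k 1 x = x := by
  simp [act_eq_actHom]

@[simp] theorem act_inv_act (g : F k) (x : Boundary k) : act k g⁻¹ (act k g x) = x := by
  rw [← act_mul]; simp

@[simp] theorem act_act_inv (g : F k) (x : Boundary k) : act k g (act k g⁻¹ x) = x := by
  rw [← act_mul]; simp

theorem act_el (a : L k) (x : Boundary k) : act k (el k a) x = step a x := by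
  rw [act_eq_actHom, el, actHom_mk]; simp [stepEquiv]

theorem act_el_head (a : L k) (x : Boundary k) :
    (act k (el k a) x).1 0 = a ↔ x.1 0 ≠ linv k a := by
  rw [act_el, step_head]

theorem act_el_inv_head (a : L k) (x : Boundary k) :
    (act k (el k a)⁻¹ x).1 0 = linv k a ↔ x.1 0 ≠ a := by
  rw [el_inv, act_el_head, linv_linv]

theorem isReduced_cons_cons {a b : L k} {w : List (L k)} :
    FreeGroup.IsReduced (a :: b :: w) ↔ b ≠ linv k a ∧ FreeGroup.IsReduced (b :: w) := by
  rw [FreeGroup.isReduced_cons_cons]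
  refine and_congr_left fun _ => ?_
  rcases a with ⟨i, s⟩
  rcases b with ⟨j, t⟩
  cases s <;> cases t <;> simp [linv, eq_comm]

/-- A ray starts with the reduced word `w` ending in `a` iff stripping `w` from it does not
produce a ray starting with the inverse of `a`. -/
theorem prefix_iff_strip (w : List (L k)) (a : L k) (hw : FreeGroup.IsReduced (w ++ [a]))
    (x : Boundary k) :
    (∀ i (h : i < (w ++ [a]).length), x.1 i = (w ++ [a])[i]) ↔
      (act k (FreeGroup.mk (w ++ [a]))⁻¹ x).1 0 ≠ linv k a := by
  induction w generalizing x with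
  | nil =>
    change _ ↔ (act k (el k a)⁻¹ x).1 0 ≠ linv k a
    rw [ne_eq, act_el_inv_head, not_not]
    constructor
    · intro h; exact h 0 (by simp)
    · intro h i hi
      obtain rfl : i = 0 := by simpa using hi
      exact h
  | cons c w ih =>
    have hw' : FreeGroup.IsReduced (w ++ [a]) := List.IsChain.tail hw
    rw [List.cons_append, mk_cons, mul_inv_rev, act_mul, ← ih hw']
    have key : (∀ i (h : i < (c :: (w ++ [a])).length), x.1 i = (c :: (w ++ [a]))[i]) ↔
        x.1 0 = c ∧ ∀ i (h : i < (w ++ [a]).length), x.1 (i + 1) = (w ++ [a])[i] := by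
      constructor
      · intro h
        exact ⟨h 0 (by simp), fun i hi => h (i + 1) (by simpa using hi)⟩
      · rintro ⟨h0, h⟩ i hi
        cases i with
        | zero => exact h0
        | succ i => exact h i (by simpa using hi)
    rw [key]
    by_cases hx : x.1 0 = c
    · have : act k (el k c)⁻¹ x = Tmap k x := by
        rw [el_inv, act_el, step_of_eq]; simpa using hx
      simp only [hx, true_and, this]
      rfl
    · simp only [hx, false_and, false_iff]
      intro h
      have h0 := h 0 (by simp)
      rw [(act_el_inv_head c x).2 hx] at h0
      obtain ⟨d, r, hd⟩ : ∃ d r, w ++ [a] = d :: r := by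
        cases w with
        | nil => exact ⟨a, [], rfl⟩
        | cons d w => exact ⟨d, w ++ [a], rfl⟩
      rw [List.cons_append, hd, isReduced_cons_cons] at hw
      simp only [hd, List.getElem_cons_zero] at h0
      exact hw.1 h0.symm

theorem mem_Cyl_iff_strip {g : F k} {w : List (L k)} {a : L k} (hg : g.toWord = w ++ [a])
    (x : Boundary k) : x ∈ Cyl k g ↔ (act k g⁻¹ x).1 0 ≠ linv k a := by
  have hr : FreeGroup.IsReduced (w ++ [a]) := hg ▸ FreeGroup.isReduced_toWord
  have h := prefix_iff_strip w a hr x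
  rw [← hg, FreeGroup.mk_toWord] at h
  rw [← h]
  exact ⟨fun h i hi => h ⟨i, hi⟩, fun h i => h i.1 i.2⟩

theorem mem_Cyl_el (a : L k) (x : Boundary k) : x ∈ Cyl k (el k a) ↔ x.1 0 = a := by
  rw [mem_Cyl_iff_strip (w := []) (a := a) (el_toWord a), ne_eq, act_el_inv_head, not_not]

theorem Cyl_one : Cyl k (1 : F k) = Set.univ := by
  apply Set.eq_univ_of_forall
  intro x i
  exact absurd i.2 (by simp)

end Letters

/-! ### Equivariance of boundary extensions -/

section Equivariance

variable {k : ℕ}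

theorem toWord_el_mul {a b : L k} {g : F k} {r : List (L k)} (hg : g.toWord = b :: r) :
    (el k a * g).toWord = if b = linv k a then r else a :: b :: r := by
  rw [FreeGroup.toWord_mul, el_toWord, List.singleton_append, FreeGroup.reduce.cons,
    FreeGroup.reduce_toWord, hg]
  have : (a.1 = b.1 ∧ a.2 = !b.2) ↔ b = linv k a := by
    rcases a with ⟨i, s⟩
    rcases b with ⟨j, t⟩
    cases s <;> cases t <;> simp [linv, eq_comm]
  simp only [this]

theorem WordTendsto.unique {pn : ℕ → F k} {p p' : Boundary k} (h : WordTendsto k pn p)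
    (h' : WordTendsto k pn p') : p = p' := by
  apply Boundary.ext
  intro m
  obtain ⟨N, hN⟩ := h (m + 1)
  obtain ⟨N', hN'⟩ := h' (m + 1)
  have := (hN _ (le_max_left N N')).symm.trans (hN' _ (le_max_right N N'))
  exact congrFun (List.ofFn_injective this) ⟨m, by simp⟩

theorem WordTendsto.succ {pn : ℕ → F k} {p : Boundary k} (h : WordTendsto k pn p) :
    WordTendsto k (fun n => pn (n + 1)) p := fun m => by
  obtain ⟨N, hN⟩ := h m
  exact ⟨N, fun n hn => hN _ (by omega)⟩

theorem WordTendsto.el_mul {pn : ℕ → F k} {p : Boundary k} (h : WordTendsto k pn p) (a : L k) :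
    WordTendsto k (fun n => el k a * pn n) (act k (el k a) p) := by
  intro m
  obtain ⟨N, hN⟩ := h (m + 1)
  refine ⟨N, fun n hn => ?_⟩
  have h1 := hN n hn
  rw [List.ofFn_succ] at h1
  cases hw : (pn n).toWord with
  | nil => simp [hw] at h1
  | cons b r =>
    rw [hw, List.take_succ_cons, List.cons_eq_cons] at h1
    obtain ⟨rfl, h2⟩ := h1
    simp only [Fin.val_zero, Fin.val_succ] at h2 hw ⊢
    rw [toWord_el_mul hw, act_el]
    split_ifs with h
    · rw [h2, step_of_eq h]; rfl
    · cases m with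
      | zero => simp
      | succ m =>
        rw [step_of_ne h, List.ofFn_succ, List.take_succ_cons]
        congr 1
        cases m with
        | zero => simp
        | succ m =>
          rw [List.ofFn_succ, List.take_succ_cons]
          congr 1
          have := congrArg (List.take m) h2
          rw [List.take_take, min_eq_left (by omega)] at this
          rw [this]
          apply List.ext_getElem
          · simp [-List.ofFn_succ]
            omega
          · intro i h1 h2
            simp [cons, -List.ofFn_succ]

theorem WordTendsto.mul {pn : ℕ → F k} {p : Boundary k} (h : WordTendsto k pn p) (g : F k) :
    WordTendsto k (fun n => g * pn n) (act k g p) := by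
  induction g using el_induction with
  | h1 => simpa using h
  | hmul a g ih =>
    simp only [mul_assoc, act_mul]
    exact ih.el_mul a

theorem prefixEl_succ (x : Boundary k) (n : ℕ) :
    prefixEl k x (n + 1) = el k (x.1 0) * prefixEl k (Tmap k x) n := by
  rw [prefixEl, List.ofFn_succ, mk_cons]
  rfl

/-- A boundary extension is equivariant. -/
theorem IsBdryExt.act_el {Φ : F k ≃* F k} {b : Boundary k → Boundary k} (h : IsBdryExt k Φ b)
    (a : L k) (x : Boundary k) : b (act k (el k a) x) = act k (Φ (el k a)) (b x) := by
  have hb : ∀ y, WordTendsto k (fun n => Φ (prefixEl k y n)) (b y) := h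
  rw [FGC.act_el]
  by_cases hx : x.1 0 = linv k a
  · refine (hb (step a x)).unique ?_
    convert (hb x).succ.mul (Φ (el k a)) using 2 with n
    rw [← map_mul, prefixEl_succ, hx, ← el_inv, mul_inv_cancel_left, step_of_eq hx]
  · refine (hb (step a x)).succ.unique ?_
    convert (hb x).mul (Φ (el k a)) using 2 with n
    rw [← map_mul, prefixEl_succ, (step_head a x).2 hx]
    congr 3
    apply Boundary.ext
    intro i
    simp [Tmap, shift, step_of_ne hx, cons]

theorem IsBdryExt.act {Φ : F k ≃* F k} {b : Boundary k → Boundary k} (h : IsBdryExt k Φ b)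
    (g : F k) (x : Boundary k) : b (act k g x) = FGC.act k (Φ g) (b x) := by
  induction g using el_induction with
  | h1 => simp
  | hmul a g ih => rw [act_mul, h.act_el, ih, map_mul, act_mul]

end Equivariance

/-! ### Measurability -/

section Measurability

variable {k : ℕ}

instance : SecondCountableTopology (Boundary k) :=
  have : SecondCountableTopology (Fin k) :=
    DiscreteTopology.secondCountableTopology_of_countable
  have : SecondCountableTopology (L k) := inferInstance
  have : SecondCountableTopology (ℕ → L k) := inferInstance
  TopologicalSpace.Subtype.secondCountableTopology { x : ℕ → L k | Red k x }

theorem continuous_letter (n : ℕ) : Continuous fun x : Boundary k => x.1 n :=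
  (continuous_apply n).comp continuous_subtype_val

theorem isOpen_Cyl (v : F k) : IsOpen (Cyl k v) := by
  have : Cyl k v = ⋂ i : Fin v.toWord.length, {x | x.1 i = v.toWord.get i} := by
    ext x; simp [Cyl]
  rw [this]
  exact isOpen_iInter_of_finite fun i =>
    (isOpen_discrete {v.toWord.get i}).preimage (continuous_letter (k := k) i)

theorem prefixEl_toWord (x : Boundary k) (n : ℕ) :
    (prefixEl k x n).toWord = List.ofFn fun i : Fin n => x.1 i := by
  rw [prefixEl, FreeGroup.toWord_mk]
  apply FreeGroup.IsReduced.reduce_eq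
  induction n generalizing x with
  | zero => simp
  | succ n ih =>
    cases n with
    | zero => simp
    | succ n =>
      have h := ih (Tmap k x)
      rw [List.ofFn_succ] at h ⊢
      rw [List.ofFn_succ, isReduced_cons_cons]
      exact ⟨x.2 0, h⟩

theorem mem_Cyl_prefixEl (x y : Boundary k) (n : ℕ) :
    y ∈ Cyl k (prefixEl k x n) ↔ ∀ i < n, y.1 i = x.1 i := by
  simp only [Cyl, Set.mem_ofPred_eq, prefixEl_toWord, List.get_eq_getElem, List.getElem_ofFn]
  constructor
  · intro h i hi
    exact h ⟨i, by simpa [prefixEl_toWord] using hi⟩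
  · intro h i
    exact h i (by simpa [prefixEl_toWord, -Fin.is_lt] using i.2)

theorem isTopologicalBasis_Cyl : TopologicalSpace.IsTopologicalBasis (Set.range (Cyl k)) := by
  apply TopologicalSpace.isTopologicalBasis_of_isOpen_of_nhds
  · rintro _ ⟨v, rfl⟩
    exact isOpen_Cyl v
  · intro x U hxU hU
    obtain ⟨V, hV, rfl⟩ := isOpen_induced_iff.1 hU
    obtain ⟨I, u, hu, hIV⟩ := isOpen_pi_iff.1 hV x.1 hxU
    refine ⟨_, ⟨prefixEl k x (I.sup id + 1), rfl⟩, ?_, ?_⟩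
    · rw [mem_Cyl_prefixEl]; simp
    · intro y hy
      rw [mem_Cyl_prefixEl] at hy
      apply hIV
      intro i hi
      rw [hy i (Nat.lt_succ_of_le (Finset.le_sup (f := id) hi))]
      exact (hu i hi).2

theorem generateFrom_Cyl :
    MeasurableSpace.generateFrom (Set.range (Cyl k)) = instMeasurableSpaceBoundary k :=
  (BorelSpace.measurable_eq.trans isTopologicalBasis_Cyl.borel_eq_generateFrom).symm

theorem isPiSystem_Cyl : IsPiSystem (Set.range (Cyl k)) := by
  have key : ∀ u v : F k, u.toWord.length ≤ v.toWord.length → (Cyl k u ∩ Cyl k v).Nonempty →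
      Cyl k u ∩ Cyl k v = Cyl k v := by
    rintro u v huv ⟨x, hxu, hxv⟩
    rw [Set.inter_eq_right]
    intro y hy i
    have h1 := hxu i
    have h2 := hxv ⟨i, i.2.trans_le huv⟩
    have h3 := hy ⟨i, i.2.trans_le huv⟩
    exact h3.trans (h2.symm.trans h1)
  rintro _ ⟨u, rfl⟩ _ ⟨v, rfl⟩ h
  rcases le_total u.toWord.length v.toWord.length with huv | huv
  · exact ⟨v, (key u v huv h).symm⟩
  · rw [Set.inter_comm] at h ⊢
    exact ⟨u, (key v u huv h).symm⟩

theorem measurableSet_Cyl (v : F k) : MeasurableSet (Cyl k v) := (isOpen_Cyl v).measurableSet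

theorem measurableSet_letter (n : ℕ) (a : L k) : MeasurableSet {x : Boundary k | x.1 n = a} :=
  ((isOpen_discrete {a}).preimage (continuous_letter (k := k) n)).measurableSet

theorem measurable_of_letter {α : Type*} [MeasurableSpace α] {f : α → Boundary k}
    (hf : ∀ n a, MeasurableSet {x | (f x).1 n = a}) : Measurable f := by
  refine Measurable.mono (measurable_generateFrom ?_) le_rfl generateFrom_Cyl.ge
  rintro _ ⟨v, rfl⟩
  have : f ⁻¹' Cyl k v = ⋂ i : Fin v.toWord.length, {x | (f x).1 i = v.toWord.get i} := by
    ext x; simp [Cyl]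
  rw [this]
  exact MeasurableSet.iInter fun i => hf _ _

theorem measurableSet_prefixEl (n : ℕ) (S : Set (F k)) :
    MeasurableSet {x : Boundary k | prefixEl k x n ∈ S} := by
  have hc : Continuous fun (x : Boundary k) (i : Fin n) => x.1 i :=
    continuous_pi fun i => continuous_letter i
  exact ((isOpen_discrete {w : Fin n → L k | FreeGroup.mk (List.ofFn w) ∈ S}).preimage
    hc).measurableSet

theorem IsBdryExt.measurable {Φ : F k ≃* F k} {b : Boundary k → Boundary k}
    (h : IsBdryExt k Φ b) : Measurable b := by
  apply measurable_of_letter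
  intro m a
  have : {x | (b x).1 m = a} = ⋃ N : ℕ, ⋂ n ≥ N,
      {x : Boundary k | prefixEl k x n ∈ {g : F k | (Φ g).toWord[m]? = some a}} := by
    ext x
    simp only [Set.mem_ofPred_eq, Set.mem_iUnion, Set.mem_iInter]
    obtain ⟨N, hN⟩ := h x (m + 1)
    have key : ∀ n ≥ N, (Φ (prefixEl k x n)).toWord[m]? = some ((b x).1 m) := by
      intro n hn
      have := congrArg (fun l => l[m]?) (hN n hn)
      simpa [List.getElem?_take_of_lt, -List.ofFn_succ] using this
    constructor
    · rintro rfl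
      exact ⟨N, key⟩
    · rintro ⟨N', hN'⟩
      have h1 := key _ (le_max_left N N')
      rw [hN' _ (le_max_right N N')] at h1
      exact (Option.some.inj h1).symm
  rw [this]
  exact MeasurableSet.iUnion fun N => MeasurableSet.iInter fun n => MeasurableSet.iInter fun _ =>
    measurableSet_prefixEl n _

theorem measurable_act (g : F k) : Measurable (FGC.act k g) := by
  induction g using el_induction with
  | h1 => exact (funext act_one : act k 1 = id) ▸ measurable_id
  | hmul a g ih =>
    have hs : Measurable (act k (el k a)) := by
      simp only [funext (act_el a)]
      apply measurable_of_letter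
      intro n c
      have : {x : Boundary k | (step a x).1 n = c} =
          ({x | x.1 0 = linv k a} ∩ {x | x.1 (n + 1) = c}) ∪
          ({x | x.1 0 = linv k a}ᶜ ∩ {x | cons k a x.1 n = c}) := by
        ext x
        by_cases hx : x.1 0 = linv k a
        · simp [hx, step_of_eq, Tmap, shift]
        · simp [hx, step_of_ne]
      rw [this]
      refine ((measurableSet_letter _ _).inter (measurableSet_letter _ _)).union
        ((measurableSet_letter _ _).compl.inter ?_)
      cases n with
      | zero => exact MeasurableSet.const (a = c)
      | succ n => exact measurableSet_letter n c
    exact (funext (act_mul _ _) : act k (el k a * g) = _) ▸ hs.comp ih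

end Measurability

/-! ### The uniform current is a multiple of the product measure on the base-ball -/

section Uniform

variable {k : ℕ}

/-- `μ` is the uniform frequency measure and `η` is the uniform current. -/
structure IsUniform (k : ℕ) (μ : Measure (Boundary k))
    (η : Measure (Boundary k × Boundary k)) : Prop where
  two_le : 2 ≤ k
  prob : IsProbabilityMeasure μ
  cyl : ∀ v : F k, v ≠ 1 →
    μ (Cyl k v) = ((2 * k : ℝ≥0∞) * (2 * k - 1) ^ (wordLength k v - 1))⁻¹
  current : IsCurrent k η
  cyl2 : ∀ x y : F k, η (Cyl2 k x y) = μ (Cyl k (x⁻¹ * y))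

/-- The set of rays with first letter `a`. -/
def Head (a : L k) : Set (Boundary k) := {x | x.1 0 = a}

theorem measurableSet_Head (a : L k) : MeasurableSet (Head a) := measurableSet_letter 0 a

theorem Head_eq_Cyl (a : L k) : Head a = Cyl k (el k a) := by
  ext x; rw [mem_Cyl_el]; rfl

theorem mem_Head_of_mem_Cyl {u : F k} {c : L k} {r : List (L k)} (hu : u.toWord = c :: r)
    {x : Boundary k} (hx : x ∈ Cyl k u) : x.1 0 = c := by
  simpa [hu] using hx ⟨0, by simp [hu]⟩

theorem toWord_inv_mul {u w : F k} {c d : L k} {r s : List (L k)} (hu : u.toWord = c :: r)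
    (hw : w.toWord = d :: s) (hcd : c ≠ d) :
    (u⁻¹ * w).toWord = u⁻¹.toWord ++ w.toWord := by
  rw [FreeGroup.toWord_mul]
  apply FreeGroup.IsReduced.reduce_eq
  refine List.isChain_append.2 ⟨FreeGroup.isReduced_toWord, FreeGroup.isReduced_toWord, ?_⟩
  intro x hx y hy
  rw [FreeGroup.toWord_inv, hu] at hx
  rw [hw] at hy
  simp only [FreeGroup.invRev, List.map_cons, List.reverse_cons, List.getLast?_concat,
    Option.mem_def, Option.some.injEq, List.head?_cons] at hx hy
  subst hx hy
  rcases c with ⟨i, b⟩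
  rcases d with ⟨j, b'⟩
  cases b <;> cases b' <;> simp_all

theorem actPair_image_eq (g : F k) (S : Set (Boundary k × Boundary k)) :
    actPair k g '' S = {p | (act k g⁻¹ p.1, act k g⁻¹ p.2) ∈ S} := by
  ext ⟨p, q⟩
  constructor
  · rintro ⟨⟨p', q'⟩, h, h'⟩
    simp only [actPair, Prod.mk.injEq] at h'
    obtain ⟨rfl, rfl⟩ := h'
    simpa using h
  · intro h
    exact ⟨_, h, by simp [actPair]⟩

theorem Cyl2_eq_prod {u w : F k} {c d : L k} {r s : List (L k)} (hu : u.toWord = c :: r)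
    (hw : w.toWord = d :: s) (hcd : c ≠ d) : Cyl2 k u w = Cyl k u ×ˢ Cyl k w := by
  obtain ⟨u', a, hua⟩ : ∃ u' a, u.toWord = u' ++ [a] :=
    ⟨_, _, (List.dropLast_append_getLast (by simp [hu])).symm⟩
  obtain ⟨w', e, hwe⟩ : ∃ w' e, w.toWord = w' ++ [e] :=
    ⟨_, _, (List.dropLast_append_getLast (by simp [hw])).symm⟩
  have huw : (u⁻¹ * w).toWord = (u⁻¹.toWord ++ w') ++ [e] := by
    rw [toWord_inv_mul hu hw hcd, hwe, List.append_assoc]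
  ext ⟨p, q⟩
  rw [Cyl2, actPair_image_eq]
  simp only [baseCyl, Set.mem_ofPred_eq, Set.mem_prod]
  rw [mem_Cyl_iff_strip huw, mem_Cyl_iff_strip hwe, ← act_mul]
  rw [show (u⁻¹ * w)⁻¹ * u⁻¹ = w⁻¹ by group, ← mem_Cyl_iff_strip hwe]
  refine and_congr_left fun hq => ?_
  have hqu : q ∉ Cyl k u := fun h =>
    hcd ((mem_Head_of_mem_Cyl hu h).symm.trans (mem_Head_of_mem_Cyl hw hq))
  rw [mem_Cyl_iff_strip hua, not_not] at hqu
  rw [hqu, mem_Cyl_iff_strip hua]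

theorem Cyl_inter_Head (u : F k) (a : L k) :
    Cyl k u ∩ Head a = ∅ ∨ ∃ u' : F k, ∃ r, u'.toWord = a :: r ∧ Cyl k u ∩ Head a = Cyl k u' := by
  cases hu : u.toWord with
  | nil =>
    obtain rfl : u = 1 := FreeGroup.toWord_eq_nil_iff.1 hu
    exact .inr ⟨el k a, [], el_toWord a, by rw [Cyl_one, Set.univ_inter, Head_eq_Cyl]⟩
  | cons c r =>
    by_cases hca : c = a
    · subst hca
      refine .inr ⟨u, r, hu, Set.inter_eq_left.2 fun x hx => mem_Head_of_mem_Cyl hu hx⟩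
    · refine .inl (Set.eq_empty_of_forall_notMem ?_)
      rintro x ⟨hx, hxa⟩
      exact hca ((mem_Head_of_mem_Cyl hu hx).symm.trans hxa)

/-- Decomposition of a measure along the values of a letter-valued function. -/
theorem measure_eq_sum_letter {α : Type*} [MeasurableSpace α] (m : Measure α) {f : α → L k}
    (hf : ∀ a, MeasurableSet (f ⁻¹' {a})) (Z : Set α) :
    m Z = ∑ a, m (Z ∩ f ⁻¹' {a}) := by
  have h := measure_biUnion_finset (μ := m.restrict Z) (s := Finset.univ)
    (f := fun a => f ⁻¹' {a})
    (fun a _ b _ hab => Set.disjoint_left.2 fun x hx hx' => hab (hx.symm.trans hx'))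
    (fun a _ => hf a)
  have hu : (⋃ a ∈ Finset.univ, f ⁻¹' {a}) = Set.univ := by ext; simp
  rw [hu, Measure.restrict_apply_univ] at h
  rw [h]
  exact Finset.sum_congr rfl fun a _ => by rw [Measure.restrict_apply (hf a), Set.inter_comm]

variable {μ : Measure (Boundary k)} {η : Measure (Boundary k × Boundary k)}

namespace IsUniform

theorem two_le_real (h : IsUniform k μ η) : (2 : ℝ) ≤ k := by exact_mod_cast h.two_le

theorem cyl_ofReal (h : IsUniform k μ η) {v : F k} (hv : v ≠ 1) :
    μ (Cyl k v) = ENNReal.ofReal ((2 * k * (2 * k - 1) ^ (wordLength k v - 1) : ℝ)⁻¹) := by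
  have hk := h.two_le_real
  have h1 : (2 * k - 1 : ℝ≥0∞) = ENNReal.ofReal (2 * k - 1) := by
    rw [ENNReal.ofReal_sub _ zero_le_one, ENNReal.ofReal_mul (by norm_num)]
    simp
  have h2 : (2 * k : ℝ≥0∞) = ENNReal.ofReal (2 * k) := by
    rw [ENNReal.ofReal_mul (by norm_num)]
    simp
  have h3 : (0 : ℝ) < 2 * k - 1 := by linarith
  rw [h.cyl v hv, h1, h2, ← ENNReal.ofReal_pow h3.le, ← ENNReal.ofReal_mul (by linarith),
    ENNReal.ofReal_inv_of_pos (by positivity)]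

theorem measure_Head (h : IsUniform k μ η) (a : L k) :
    μ (Head a) = ENNReal.ofReal ((2 * k : ℝ)⁻¹) := by
  have h1 : el k a ≠ 1 := fun h => by simpa [h] using el_toWord a
  rw [Head_eq_Cyl, h.cyl_ofReal h1, wordLength, el_toWord]
  simp

theorem prod_Cyl (h : IsUniform k μ η) {u w : F k} {c d : L k} {r s : List (L k)}
    (hu : u.toWord = c :: r) (hw : w.toWord = d :: s) (hcd : c ≠ d) :
    η (Cyl k u ×ˢ Cyl k w) =
      ENNReal.ofReal (2 * k / (2 * k - 1)) * μ (Cyl k u) * μ (Cyl k w) := by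
  have hk := h.two_le_real
  have h3 : (0 : ℝ) < 2 * k - 1 := by linarith
  have hne : ∀ {v : F k} {c r}, v.toWord = c :: r → v ≠ 1 := by
    rintro v c r hv rfl
    simp at hv
  have huw := toWord_inv_mul hu hw hcd
  have huw1 : u⁻¹ * w ≠ 1 := fun h => by simp [h, hw] at huw
  rw [← Cyl2_eq_prod hu hw hcd, h.cyl2, h.cyl_ofReal huw1, h.cyl_ofReal (hne hu),
    h.cyl_ofReal (hne hw), ← ENNReal.ofReal_mul (by positivity),
    ← ENNReal.ofReal_mul (by positivity)]
  congr 1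
  rw [wordLength, wordLength, wordLength, huw, FreeGroup.toWord_inv, List.length_append,
    FreeGroup.invRev_length, hu, hw]
  simp only [List.length_cons, add_tsub_cancel_right]
  rw [show r.length + 1 + (s.length + 1) - 1 = r.length + s.length + 1 by omega]
  field_simp
  ring

theorem prod_Head (h : IsUniform k μ η) {a b : L k} (hab : a ≠ b) {X Y : Set (Boundary k)}
    (hX : MeasurableSet X) (hY : MeasurableSet Y) :
    η ((X ∩ Head a) ×ˢ (Y ∩ Head b)) =
      ENNReal.ofReal (2 * k / (2 * k - 1)) * μ (X ∩ Head a) * μ (Y ∩ Head b) := by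
  have := h.prob
  have hspan : ∀ m : Measure (Boundary k), IsFiniteMeasure m →
      Nonempty (m.FiniteSpanningSetsIn (Set.range (Cyl k))) := fun m _ =>
    ⟨⟨fun _ => Set.univ, fun _ => ⟨1, Cyl_one⟩, fun _ => measure_lt_top m _, Set.iUnion_const _⟩⟩
  have hfin : IsFiniteMeasure (ENNReal.ofReal (2 * k / (2 * k - 1)) • μ.restrict (Head a)) :=
    ⟨by
      rw [Measure.smul_apply, smul_eq_mul]
      exact ENNReal.mul_lt_top ENNReal.ofReal_lt_top (measure_lt_top _ _)⟩
  obtain ⟨h1⟩ := hspan _ hfin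
  obtain ⟨h2⟩ := hspan (μ.restrict (Head b)) inferInstance
  have key := Measure.prod_eq_generateFrom generateFrom_Cyl generateFrom_Cyl isPiSystem_Cyl
    isPiSystem_Cyl h1 h2 (μν := η.restrict (Head a ×ˢ Head b)) (by
      rintro _ ⟨u, rfl⟩ _ ⟨w, rfl⟩
      rw [Measure.restrict_apply ((measurableSet_Cyl u).prod (measurableSet_Cyl w)),
        Measure.smul_apply, Measure.restrict_apply (measurableSet_Cyl u),
        Measure.restrict_apply (measurableSet_Cyl w), Set.prod_inter_prod, smul_eq_mul]
      rcases Cyl_inter_Head u a with hu | ⟨u', r, hr, hu⟩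
      · simp [hu]
      rcases Cyl_inter_Head w b with hw | ⟨w', s, hs, hw⟩
      · simp [hw]
      rw [hu, hw, h.prod_Cyl hr hs hab])
  have key2 := congrArg (fun m => m (X ×ˢ Y)) key
  simp only [Measure.prod_prod, Measure.smul_apply, smul_eq_mul] at key2
  rw [Measure.restrict_apply hX, Measure.restrict_apply hY, Measure.restrict_apply (hX.prod hY),
    Set.prod_inter_prod] at key2
  exact key2.symm

theorem prod_Head_diff (h : IsUniform k μ η) (a : L k) {X Y : Set (Boundary k)}
    (hX : MeasurableSet X) (hY : MeasurableSet Y) :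
    η ((X ∩ Head a) ×ˢ (Y \ Head a)) =
      ENNReal.ofReal (2 * k / (2 * k - 1)) * μ (X ∩ Head a) * μ (Y \ Head a) := by
  rw [measure_eq_sum_letter η (f := fun p => p.2.1 0)
      (fun b => measurable_snd (measurableSet_Head b)),
    measure_eq_sum_letter μ (f := fun x => x.1 0) measurableSet_Head (Y \ Head a),
    Finset.mul_sum]
  refine Finset.sum_congr rfl fun b _ => ?_
  have h1 : (X ∩ Head a) ×ˢ (Y \ Head a) ∩ (fun p : Boundary k × Boundary k => p.2.1 0) ⁻¹' {b} =
      (X ∩ Head a) ×ˢ ((Y \ Head a) ∩ Head b) := by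
    ext ⟨p, q⟩; simp [Head, and_assoc]
  rw [h1]
  by_cases hab : a = b
  · subst hab
    have : (Y \ Head a) ∩ Head a = ∅ := Set.sdiff_inter_self
    have h2 : (Y \ Head a) ∩ (fun x : Boundary k => x.1 0) ⁻¹' {a} = ∅ := this
    rw [this, h2]; simp
  · exact h.prod_Head hab hX (hY.diff (measurableSet_Head a))

theorem prod_diff_Head (h : IsUniform k μ η) (a : L k) {X Y : Set (Boundary k)}
    (hX : MeasurableSet X) (hY : MeasurableSet Y) :
    η ((Y \ Head a) ×ˢ (X ∩ Head a)) =
      ENNReal.ofReal (2 * k / (2 * k - 1)) * μ (X ∩ Head a) * μ (Y \ Head a) := by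
  rw [measure_eq_sum_letter η (f := fun p => p.1.1 0)
      (fun b => measurable_fst (measurableSet_Head b)),
    measure_eq_sum_letter μ (f := fun x => x.1 0) measurableSet_Head (Y \ Head a),
    Finset.mul_sum]
  refine Finset.sum_congr rfl fun b _ => ?_
  have h1 : (Y \ Head a) ×ˢ (X ∩ Head a) ∩ (fun p : Boundary k × Boundary k => p.1.1 0) ⁻¹' {b} =
      ((Y \ Head a) ∩ Head b) ×ˢ (X ∩ Head a) := by
    ext ⟨p, q⟩
    simp only [Set.mem_inter_iff, Set.mem_prod, Set.mem_preimage, Set.mem_singleton_iff, Head,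
      Set.mem_ofPred_eq]
    tauto
  rw [h1]
  by_cases hab : a = b
  · subst hab
    have : (Y \ Head a) ∩ Head a = ∅ := Set.sdiff_inter_self
    have h2 : (Y \ Head a) ∩ (fun x : Boundary k => x.1 0) ⁻¹' {a} = ∅ := this
    rw [this, h2]; simp
  · rw [h.prod_Head (Ne.symm hab) (hY.diff (measurableSet_Head a)) hX, mul_right_comm]
    rfl

theorem real_compl_Head (h : IsUniform k μ η) (a : L k) :
    μ.real (Set.univ \ Head a) = (2 * k - 1) / (2 * k) := by
  have := h.prob
  have hk := h.two_le_real
  rw [← Set.compl_eq_univ_sdiff, probReal_compl_eq_one_sub (measurableSet_Head a), measureReal_def,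
    h.measure_Head, ENNReal.toReal_ofReal (by positivity)]
  field_simp

/-- Stripping a common first letter scales the uniform measure by `2k - 1`. -/
theorem real_preimage_el (h : IsUniform k μ η) (a : L k) {Y : Set (Boundary k)}
    (hY : MeasurableSet Y) (hYa : Y ∩ Head a = ∅) :
    (2 * k - 1) * μ.real (act k (el k a) ⁻¹' Y) = μ.real Y := by
  have := h.prob
  have hk := h.two_le_real
  have h3 : (0 : ℝ) < 2 * k - 1 := by linarith
  have hZ : MeasurableSet (act k (el k a) ⁻¹' Y) := measurable_act _ hY
  have hYd : Y \ Head a = Y := sdiff_eq_self_iff_disjoint.2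
    (Set.disjoint_iff_inter_eq_empty.2 (by rwa [Set.inter_comm]))
  have hZa : act k (el k a) ⁻¹' Y ∩ Head (linv k a) = act k (el k a) ⁻¹' Y := by
    refine Set.inter_eq_left.2 fun x hx => ?_
    by_contra hxa
    have hmem : act k (el k a) x ∈ Y ∩ Head a := ⟨hx, (act_el_head a x).2 hxa⟩
    rw [hYa] at hmem
    exact hmem
  have h1 := h.prod_Head_diff a MeasurableSet.univ hY
  have h2 := h.prod_diff_Head (linv k a) hZ MeasurableSet.univ
  have h4 := h.current.2.1 (el k a) ((Set.univ ∩ Head a) ×ˢ (Y \ Head a))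
    ((MeasurableSet.univ.inter (measurableSet_Head a)).prod (hY.diff (measurableSet_Head a)))
  have h5 : actPair k (el k a) ⁻¹' ((Set.univ ∩ Head a) ×ˢ (Y \ Head a)) =
      (Set.univ \ Head (linv k a)) ×ˢ (act k (el k a) ⁻¹' Y ∩ Head (linv k a)) := by
    rw [hYd, hZa]
    ext ⟨p, q⟩
    simp [actPair, Head, act_el_head]
  rw [h5, h1, h2, hYd, hZa, Set.univ_inter] at h4
  have h6 := congrArg ENNReal.toReal h4
  simp only [ENNReal.toReal_mul, h.measure_Head, ← measureReal_def] at h6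
  rw [h.real_compl_Head, ENNReal.toReal_ofReal (by positivity),
    ENNReal.toReal_ofReal (by positivity)] at h6
  field_simp at h6
  linarith

/-- Translation by a letter distorts the uniform measure at most by the factor `2k - 1`. -/
theorem real_preimage_el_le (h : IsUniform k μ η) (a : L k) {Y : Set (Boundary k)}
    (hY : MeasurableSet Y) :
    μ.real (act k (el k a) ⁻¹' Y) ≤ (2 * k - 1) * μ.real Y := by
  have := h.prob
  have hk := h.two_le_real
  have h1 := h.real_preimage_el a (hY.diff (measurableSet_Head a)) Set.sdiff_inter_self
  have hW : MeasurableSet (act k (el k a) ⁻¹' (Y ∩ Head a)) :=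
    measurable_act _ (hY.inter (measurableSet_Head a))
  have h2 := h.real_preimage_el (linv k a) hW (by
    refine Set.eq_empty_of_forall_notMem ?_
    rintro x ⟨⟨-, hx⟩, hxa⟩
    exact (act_el_head a x).1 hx hxa)
  have h3 : act k (el k (linv k a)) ⁻¹' (act k (el k a) ⁻¹' (Y ∩ Head a)) = Y ∩ Head a := by
    ext x
    rw [← el_inv]
    simp
  rw [h3] at h2
  have h4 : act k (el k a) ⁻¹' Y =
      act k (el k a) ⁻¹' (Y ∩ Head a) ∪ act k (el k a) ⁻¹' (Y \ Head a) := by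
    rw [← Set.preimage_union, Set.inter_union_sdiff]
  have h5 : μ.real (act k (el k a) ⁻¹' Y) = μ.real (act k (el k a) ⁻¹' (Y ∩ Head a)) +
      μ.real (act k (el k a) ⁻¹' (Y \ Head a)) := by
    rw [h4]
    exact measureReal_union ((Set.disjoint_sdiff_inter.symm).preimage _)
      (measurable_act _ (hY.diff (measurableSet_Head a)))
  have h6 : μ.real Y = μ.real (Y ∩ Head a) + μ.real (Y \ Head a) :=
    (measureReal_inter_add_sdiff₀ (measurableSet_Head a).nullMeasurableSet).symm
  have h7 : 0 ≤ μ.real (act k (el k a) ⁻¹' (Y \ Head a)) := measureReal_nonneg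
  rw [h5, h6, ← h2, ← h1]
  nlinarith [mul_nonneg (by linarith : (0 : ℝ) ≤ 2 * k - 1 - 1) h7,
    mul_nonneg (by linarith : (0 : ℝ) ≤ 2 * k - 1) h7]

theorem mem_baseBall (p : Boundary k × Boundary k) : p ∈ baseBall k ↔ p.1.1 0 ≠ p.2.1 0 := by
  simp [baseBall, baseCyl, Cyl_one]

theorem measurableSet_baseBall : MeasurableSet (baseBall k) := by
  have : baseBall k = (⋃ a, Head a ×ˢ Head a)ᶜ := by
    ext p
    simp [mem_baseBall, Head, eq_comm]
  rw [this]
  exact (MeasurableSet.iUnion fun a => (measurableSet_Head a).prod (measurableSet_Head a)).compl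

theorem baseBall_fst_le (h : IsUniform k μ η) {X : Set (Boundary k)} (hX : MeasurableSet X) :
    η (baseBall k ∩ Prod.fst ⁻¹' X) ≤ ENNReal.ofReal (2 * k / (2 * k - 1)) * μ X := by
  have := h.prob
  rw [measure_eq_sum_letter η (f := fun p => p.1.1 0)
      (fun b => measurable_fst (measurableSet_Head b)),
    measure_eq_sum_letter μ (f := fun x => x.1 0) measurableSet_Head X, Finset.mul_sum]
  refine Finset.sum_le_sum fun a _ => ?_
  refine (measure_mono ?_).trans ((h.prod_Head_diff a hX MeasurableSet.univ).le.trans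
    (mul_le_of_le_one_right' prob_le_one))
  rintro ⟨p, q⟩ ⟨⟨hB, hp⟩, hpa⟩
  rw [mem_baseBall] at hB
  refine ⟨⟨hp, hpa⟩, trivial, fun hq => hB ?_⟩
  exact Eq.trans hpa (Eq.symm hq)

theorem baseBall_snd_le (h : IsUniform k μ η) {X : Set (Boundary k)} (hX : MeasurableSet X) :
    η (baseBall k ∩ Prod.snd ⁻¹' X) ≤ ENNReal.ofReal (2 * k / (2 * k - 1)) * μ X := by
  have := h.prob
  rw [measure_eq_sum_letter η (f := fun p => p.2.1 0)
      (fun b => measurable_snd (measurableSet_Head b)),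
    measure_eq_sum_letter μ (f := fun x => x.1 0) measurableSet_Head X, Finset.mul_sum]
  refine Finset.sum_le_sum fun a _ => ?_
  refine (measure_mono ?_).trans ((h.prod_diff_Head a hX MeasurableSet.univ).le.trans
    (mul_le_of_le_one_right' prob_le_one))
  rintro ⟨p, q⟩ ⟨⟨hB, hq⟩, hqa⟩
  rw [mem_baseBall] at hB
  refine ⟨⟨trivial, fun hp => hB ?_⟩, hq, hqa⟩
  exact Eq.trans hp (Eq.symm hqa)

theorem real_eq_sum_Head (h : IsUniform k μ η) (E : Set (Boundary k)) :
    μ.real E = ∑ a, μ.real (E ∩ Head a) := by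
  have := h.prob
  rw [measureReal_def, measure_eq_sum_letter μ (f := fun x => x.1 0) measurableSet_Head E,
    ENNReal.toReal_sum fun a _ => measure_ne_top _ _]
  rfl

/-- A set of rays of measure `t` is separated from its complement by geodesics through the
base point of total mass at least `t (1 - t)`. -/
theorem le_baseBall_inter_prod_compl (h : IsUniform k μ η) {E : Set (Boundary k)}
    (hE : MeasurableSet E) :
    ENNReal.ofReal (μ.real E * (1 - μ.real E)) ≤ η (baseBall k ∩ E ×ˢ Eᶜ) := by
  have := h.prob
  have hk := h.two_le_real
  have h3 : (0 : ℝ) < 2 * k - 1 := by linarith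
  have hsum : η (baseBall k ∩ E ×ˢ Eᶜ) = ENNReal.ofReal (∑ a, 2 * k / (2 * k - 1) *
      μ.real (E ∩ Head a) * μ.real (Eᶜ \ Head a)) := by
    rw [measure_eq_sum_letter η (f := fun p => p.1.1 0)
      (fun b => measurable_fst (measurableSet_Head b)), ENNReal.ofReal_sum_of_nonneg
        fun a _ => by positivity]
    refine Finset.sum_congr rfl fun a _ => ?_
    rw [ENNReal.ofReal_mul (by positivity), ENNReal.ofReal_mul (by positivity),
      ofReal_measureReal, ofReal_measureReal, ← h.prod_Head_diff a hE hE.compl]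
    congr 1
    ext ⟨p, q⟩
    simp only [Set.mem_inter_iff, mem_baseBall, Set.mem_prod, Set.mem_preimage,
      Set.mem_singleton_iff, Head, Set.mem_ofPred_eq, Set.mem_sdiff]
    grind
  rw [hsum]
  apply ENNReal.ofReal_le_ofReal
  have hx : ∀ a : L k, μ.real (Eᶜ \ Head a) =
      1 - μ.real E - (2 * k : ℝ)⁻¹ + μ.real (E ∩ Head a) := by
    intro a
    have h1 : μ.real Eᶜ = μ.real (Eᶜ ∩ Head a) + μ.real (Eᶜ \ Head a) :=
      (measureReal_inter_add_sdiff₀ (measurableSet_Head a).nullMeasurableSet).symm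
    have h2 : μ.real (Head a) = μ.real (Head a ∩ E) + μ.real (Head a \ E) :=
      (measureReal_inter_add_sdiff₀ hE.nullMeasurableSet).symm
    have h4 : μ.real (Head a) = (2 * k : ℝ)⁻¹ := by
      rw [measureReal_def, h.measure_Head, ENNReal.toReal_ofReal (by positivity)]
    rw [probReal_compl_eq_one_sub hE] at h1
    rw [h4, Set.inter_comm, Set.sdiff_eq, Set.inter_comm _ Eᶜ] at h2
    linarith
  simp only [hx]
  set t := μ.real E
  have hcs : t ^ 2 ≤ 2 * k * ∑ a : L k, μ.real (E ∩ Head a) ^ 2 := by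
    have := sq_sum_le_card_mul_sum_sq (s := Finset.univ) (f := fun a : L k => μ.real (E ∩ Head a))
    rw [← h.real_eq_sum_Head E] at this
    simpa [mul_comm] using this
  have hexp : ∑ a : L k, 2 * k / (2 * k - 1) * μ.real (E ∩ Head a) *
      (1 - t - (2 * k : ℝ)⁻¹ + μ.real (E ∩ Head a)) = 2 * k / (2 * k - 1) *
      (t * (1 - t - (2 * k : ℝ)⁻¹) + ∑ a : L k, μ.real (E ∩ Head a) ^ 2) := by
    have ht : t = ∑ a : L k, μ.real (E ∩ Head a) := h.real_eq_sum_Head E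
    conv_rhs => rw [ht, Finset.sum_mul, ← Finset.sum_add_distrib, Finset.mul_sum]
    refine Finset.sum_congr rfl fun a _ => ?_
    rw [← ht]
    ring
  rw [hexp]
  have hk0 : (0 : ℝ) < 2 * k := by linarith
  rw [div_mul_eq_mul_div, le_div_iff₀ h3, mul_add, mul_left_comm, mul_sub (2 * k : ℝ),
    mul_inv_cancel₀ hk0.ne']
  linarith

/-- The mass of the geodesics passing through both `1` and `g` decays exponentially. -/
theorem baseBall_inter_le (h : IsUniform k μ η) (g : F k) :
    η (baseBall k ∩ actPair k g⁻¹ ⁻¹' baseBall k) ≤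
      ENNReal.ofReal (2 / (2 * k - 1) ^ wordLength k g) := by
  have := h.prob
  have hk := h.two_le_real
  have h3 : (0 : ℝ) < 2 * k - 1 := by linarith
  by_cases hg : g = 1
  · subst hg
    have h1 : η (baseBall k) = 1 := by
      have := h.cyl2 1 1
      rwa [Cyl2, actPair_image_eq, inv_one, one_mul, Cyl_one, measure_univ,
        show {p : Boundary k × Boundary k | (act k 1 p.1, act k 1 p.2) ∈ baseCyl k 1} = baseBall k
          by ext p; simp [baseBall]] at this
    refine (measure_mono Set.inter_subset_left).trans ?_
    rw [h1]
    simp [wordLength]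
  · obtain ⟨w, a, hw⟩ : ∃ w a, g.toWord = w ++ [a] :=
      ⟨_, _, (List.dropLast_append_getLast (by simpa using hg)).symm⟩
    have hsub : baseBall k ∩ actPair k g⁻¹ ⁻¹' baseBall k ⊆
        (baseBall k ∩ Prod.fst ⁻¹' Cyl k g) ∪ (baseBall k ∩ Prod.snd ⁻¹' Cyl k g) := by
      rintro ⟨p, q⟩ ⟨hB, hB'⟩
      rw [Set.mem_preimage, mem_baseBall] at hB'
      by_contra hcon
      simp only [Set.mem_union, Set.mem_inter_iff, hB, true_and, Set.mem_preimage, not_or,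
        mem_Cyl_iff_strip hw, not_not] at hcon
      exact hB' (hcon.1.trans hcon.2.symm)
    refine (measure_mono hsub).trans ((measure_union_le _ _).trans ((add_le_add
      (h.baseBall_fst_le (measurableSet_Cyl g)) (h.baseBall_snd_le (measurableSet_Cyl g))).trans ?_))
    rw [h.cyl_ofReal hg, ← ENNReal.ofReal_mul (by positivity),
      ← ENNReal.ofReal_add (by positivity) (by positivity)]
    apply ENNReal.ofReal_le_ofReal
    obtain ⟨n, hn⟩ : ∃ n, wordLength k g = n + 1 := ⟨w.length, by simp [wordLength, hw]⟩
    rw [hn, Nat.add_sub_cancel]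
    apply le_of_eq
    field_simp
    ring

end IsUniform

end Uniform

/-! ### Choice of a base point and counting -/

section Counting

variable {k : ℕ} {μ : Measure (Boundary k)} {η : Measure (Boundary k × Boundary k)}

/-- For an equivariant map `b` there is a base point from which the image under `b` of the
uniform measure is not concentrated in a single direction. -/
theorem IsUniform.exists_balanced (h : IsUniform k μ η) (Φ : MulAut (F k))
    {b : Boundary k → Boundary k} (hbm : Measurable b)
    (hb : ∀ g x, b (act k g x) = act k (Φ g) (b x)) :
    ∃ m : F k, ∀ a : L k, μ.real {x | (act k m⁻¹ (b x)).1 0 = a} ≤ 1 - (4 * k : ℝ)⁻¹ := by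
  have := h.prob
  have hk := h.two_le_real
  have hc : (2 * k - 1 : ℝ) * (4 * k : ℝ)⁻¹ < 1 / 2 := by
    rw [← div_eq_mul_inv, div_lt_iff₀ (by linarith)]; linarith
  have hc0 : (4 * k : ℝ)⁻¹ ≤ 1 / 2 := by
    rw [inv_le_comm₀ (by linarith) (by norm_num)]; linarith
  by_contra! hcon
  choose a ha using hcon
  have hms : ∀ (m : F k) (c : L k), MeasurableSet {x | (act k m⁻¹ (b x)).1 0 = c} := fun m c =>
    ((measurable_act m⁻¹).comp hbm) (measurableSet_letter 0 c)
  have hcompl : ∀ (m : F k) (c : L k), μ.real {x | (act k m⁻¹ (b x)).1 0 ≠ c} =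
      1 - μ.real {x | (act k m⁻¹ (b x)).1 0 = c} := fun m c =>
    probReal_compl_eq_one_sub (hms m c)
  have hstep : ∀ (s : L k) (m : F k), a (Φ (el k s) * m) = a m := by
    intro s m
    by_contra hne
    have h1 := h.real_preimage_el_le (linv k s)
      (Y := {x | (act k m⁻¹ (b x)).1 0 ≠ a m}) (hms m (a m)).compl
    have h2 : act k (el k (linv k s)) ⁻¹' {x | (act k m⁻¹ (b x)).1 0 ≠ a m} =
        {x | (act k (Φ (el k s) * m)⁻¹ (b x)).1 0 ≠ a m} := by
      ext x
      simp [← el_inv, hb, act_mul]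
    rw [h2, hcompl m] at h1
    have h3 : μ.real {x | (act k (Φ (el k s) * m)⁻¹ (b x)).1 0 = a (Φ (el k s) * m)} ≤
        μ.real {x | (act k (Φ (el k s) * m)⁻¹ (b x)).1 0 ≠ a m} :=
      measureReal_mono fun x hx => by
        simp only [Set.mem_ofPred_eq] at hx ⊢
        rwa [hx]
    have h4 := ha (Φ (el k s) * m)
    have h5 := ha m
    nlinarith
  have hconst : ∀ g m : F k, a (Φ g * m) = a m := by
    intro g
    induction g using el_induction with
    | h1 => simp
    | hmul s g ih => intro m; rw [map_mul, mul_assoc, hstep, ih]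
  have hconst' : ∀ v : F k, a v = a 1 := fun v => by
    simpa using hconst (Φ.symm v) 1
  obtain ⟨i, hi⟩ : ∃ i : Fin k, i ≠ (a 1).1 :=
    have : Nontrivial (Fin k) := Fin.nontrivial_iff_two_le.2 h.two_le
    exists_ne _
  have h1 := ha (el k (i, true))
  have h2 := ha 1
  rw [hconst'] at h1
  have h3 : μ.real {x | (act k (el k (i, true))⁻¹ (b x)).1 0 = a 1} ≤
      μ.real {x | (act k 1⁻¹ (b x)).1 0 ≠ a 1} := by
    refine measureReal_mono fun x hx => ?_
    simp only [Set.mem_ofPred_eq, inv_one, act_one] at hx ⊢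
    intro hx'
    have h4 : (b x).1 0 ≠ (i, true) := fun h5 => hi (by rw [← hx', h5])
    have h6 := (act_el_inv_head (i, true) (b x)).2 h4
    exact hi (by rw [← hx, h6]; rfl)
  rw [hcompl] at h3
  linarith

/-- Cauchy–Schwarz estimate for the multiplicity of a family of sets. -/
theorem sq_card_mul_le {α ι : Type*} [MeasurableSpace α] (ν : Measure α) [IsFiniteMeasure ν]
    (s : Finset ι) {Y : ι → Set α} (hY : ∀ i, MeasurableSet (Y i)) {c M : ℝ} (hc : 0 ≤ c)
    (hcY : ∀ i ∈ s, c ≤ ν.real (Y i)) (hM0 : 0 < M) (hM : ν.real Set.univ ≤ M) :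
    (s.card * c) ^ 2 ≤ M * ∑ i ∈ s, ∑ j ∈ s, ν.real (Y i ∩ Y j) := by
  set t : ℝ := s.card * c / M
  have hint : ∀ A : Set α, MeasurableSet A → Integrable (A.indicator (1 : α → ℝ)) ν :=
    fun A hA => (integrable_const (1 : ℝ)).indicator hA
  have hsq : ∀ x, (∑ i ∈ s, (Y i).indicator (1 : α → ℝ) x - t) ^ 2 =
      ∑ i ∈ s, ∑ j ∈ s, (Y i ∩ Y j).indicator (1 : α → ℝ) x -
        2 * t * ∑ i ∈ s, (Y i).indicator (1 : α → ℝ) x + t ^ 2 := by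
    intro x
    have : ∑ i ∈ s, ∑ j ∈ s, (Y i ∩ Y j).indicator (1 : α → ℝ) x =
        (∑ i ∈ s, (Y i).indicator (1 : α → ℝ) x) ^ 2 := by
      rw [sq, Finset.sum_mul_sum]
      simp only [Set.inter_indicator_one, Pi.mul_apply]
    rw [this]
    ring
  have h0 : 0 ≤ ∫ x, (∑ i ∈ s, (Y i).indicator (1 : α → ℝ) x - t) ^ 2 ∂ν :=
    integral_nonneg fun x => sq_nonneg _
  have hi1 : Integrable (fun x => ∑ i ∈ s, ∑ j ∈ s, (Y i ∩ Y j).indicator (1 : α → ℝ) x) ν :=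
    integrable_finsetSum _ fun i _ => integrable_finsetSum _ fun j _ =>
      hint _ ((hY i).inter (hY j))
  have hi2 : Integrable (fun x => ∑ i ∈ s, (Y i).indicator (1 : α → ℝ) x) ν :=
    integrable_finsetSum _ fun i _ => hint _ (hY i)
  have hval : ∫ x, (∑ i ∈ s, (Y i).indicator (1 : α → ℝ) x - t) ^ 2 ∂ν =
      ∑ i ∈ s, ∑ j ∈ s, ν.real (Y i ∩ Y j) - 2 * t * ∑ i ∈ s, ν.real (Y i) +
        t ^ 2 * ν.real Set.univ := by
    simp only [hsq]
    have hi3 : Integrable (fun x => ∑ i ∈ s, ∑ j ∈ s, (Y i ∩ Y j).indicator (1 : α → ℝ) x -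
        2 * t * ∑ i ∈ s, (Y i).indicator (1 : α → ℝ) x) ν := hi1.sub (hi2.const_mul _)
    rw [integral_add hi3 (integrable_const _),
      integral_sub hi1 (hi2.const_mul _), integral_const_mul, integral_const,
      integral_finsetSum _ fun i _ => integrable_finsetSum _ fun j _ =>
        hint _ ((hY i).inter (hY j)), integral_finsetSum _ fun i _ => hint _ (hY i)]
    simp only [integral_indicator_one (hY _), smul_eq_mul]
    rw [mul_comm (ν.real Set.univ)]
    congr 2
    refine Finset.sum_congr rfl fun i _ => ?_
    rw [integral_finsetSum _ fun j _ => hint _ ((hY i).inter (hY j))]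
    simp only [integral_indicator_one ((hY i).inter (hY _))]
  have h1 : s.card * c ≤ ∑ i ∈ s, ν.real (Y i) := by
    simpa using Finset.card_nsmul_le_sum s _ c hcY
  have ht : 0 ≤ t := by positivity
  have htM : t * M = s.card * c := by simp only [t]; field_simp
  rw [hval] at h0
  set S := ∑ i ∈ s, ∑ j ∈ s, ν.real (Y i ∩ Y j)
  have h2 : 2 * t * (s.card * c) ≤ S + t ^ 2 * M := by
    nlinarith [mul_le_mul_of_nonneg_left h1 ht, mul_le_mul_of_nonneg_left hM (sq_nonneg t)]
  rw [← htM] at h2 ⊢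
  nlinarith

theorem finite_wordLength_lt (n : ℕ) : {g : F k | wordLength k g < n}.Finite :=
  Set.Finite.of_finite_image ((List.finite_length_lt (L k) n).subset (by
    rintro _ ⟨g, hg, rfl⟩; exact hg)) FreeGroup.toWord_injective.injOn

/-- A bound on the number of sets of mass at least `c` in a set of mass at most `M`, when the
sets are indexed by distinct elements of `F` and their intersections decay exponentially. -/
theorem exists_card_le (hk : 2 ≤ k) {c M : ℝ} (hc : 0 < c) (hM0 : 0 < M) :
    ∃ R : ℕ, ∀ {α : Type} [MeasurableSpace α] (ν : Measure α) [IsFiniteMeasure ν] (n : ℕ)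
      (Y : Fin n → Set α) (f : Fin n → F k), ν.real Set.univ ≤ M → f.Injective →
      (∀ i, MeasurableSet (Y i)) → (∀ i, c ≤ ν.real (Y i)) →
      (∀ i j, ν.real (Y i ∩ Y j) ≤ 2 / (2 * k - 1) ^ wordLength k (f i * (f j)⁻¹)) → n ≤ R := by
  have hk' : (2 : ℝ) ≤ k := by exact_mod_cast hk
  have h3 : (1 : ℝ) < 2 * k - 1 := by linarith
  obtain ⟨l, hl⟩ : ∃ l : ℕ, 2 / (2 * k - 1 : ℝ) ^ l ≤ c ^ 2 / (2 * M) := by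
    obtain ⟨l, hl⟩ := pow_unbounded_of_one_lt (4 * M / c ^ 2) h3
    refine ⟨l, ?_⟩
    rw [div_lt_iff₀ (by positivity)] at hl
    rw [div_le_div_iff₀ (by positivity) (by positivity)]
    linarith
  set T := (finite_wordLength_lt (k := k) l).toFinset
  refine ⟨⌈4 * M * T.card / c ^ 2⌉₊, fun {α} _ ν _ n Y f hM hf hY hcY hij => ?_⟩
  have h1 := sq_card_mul_le ν Finset.univ hY hc.le (fun i _ => hcY i) hM0 hM
  have hrow : ∀ i, ∑ j, ν.real (Y i ∩ Y j) ≤ 2 * T.card + n * (c ^ 2 / (2 * M)) := by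
    intro i
    classical
    have hle : ∀ j, ν.real (Y i ∩ Y j) ≤
        (if f i * (f j)⁻¹ ∈ T then 2 else 0) + c ^ 2 / (2 * M) := by
      intro j
      refine (hij i j).trans ?_
      split_ifs with hT
      · have : 2 / (2 * k - 1 : ℝ) ^ wordLength k (f i * (f j)⁻¹) ≤ 2 :=
          div_le_self (by norm_num) (one_le_pow₀ h3.le)
        have : 0 ≤ c ^ 2 / (2 * M) := by positivity
        linarith
      · rw [zero_add]
        refine le_trans ?_ hl
        have : l ≤ wordLength k (f i * (f j)⁻¹) := by simpa [T] using hT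
        gcongr
        exact h3.le
    refine (Finset.sum_le_sum fun j _ => hle j).trans ?_
    rw [Finset.sum_add_distrib, Finset.sum_const, Finset.card_univ, Fintype.card_fin, nsmul_eq_mul]
    gcongr
    rw [← Finset.sum_filter, Finset.sum_const, nsmul_eq_mul, mul_comm]
    have hcard : (Finset.univ.filter fun j => f i * (f j)⁻¹ ∈ T).card ≤ T.card := by
      refine Finset.card_le_card_of_injOn (fun j => f i * (f j)⁻¹) ?_ ?_
      · intro j hj; simpa using hj
      · intro j _ j' _ hjj; exact hf (by simpa using hjj)
    have : ((Finset.univ.filter fun j => f i * (f j)⁻¹ ∈ T).card : ℝ) ≤ T.card := by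
      exact_mod_cast hcard
    linarith
  have h2 : ∑ i, ∑ j, ν.real (Y i ∩ Y j) ≤ n * (2 * T.card + n * (c ^ 2 / (2 * M))) := by
    refine (Finset.sum_le_sum fun i _ => hrow i).trans_eq ?_
    rw [Finset.sum_const, Finset.card_univ, Fintype.card_fin, nsmul_eq_mul]
  have h4 : ((n : ℝ) * c) ^ 2 ≤ M * (n * (2 * T.card + n * (c ^ 2 / (2 * M)))) := by
    rw [Finset.card_univ, Fintype.card_fin] at h1
    exact h1.trans (mul_le_mul_of_nonneg_left h2 hM0.le)
  have h5 : M * (n * (2 * T.card + n * (c ^ 2 / (2 * M)))) =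
      n * (2 * M * T.card) + (n * c) ^ 2 / 2 := by
    field_simp
  rcases Nat.eq_zero_or_pos n with rfl | hn
  · exact Nat.zero_le _
  have hn' : (0 : ℝ) < n := by exact_mod_cast hn
  have h6 : (n : ℝ) ≤ 4 * M * T.card / c ^ 2 := by
    rw [le_div_iff₀ (by positivity)]
    refine le_of_mul_le_mul_left ?_ hn'
    rw [h5] at h4
    nlinarith
  exact_mod_cast h6.trans (Nat.le_ceil _)

end Counting

/-! ### Bounding the images of the basis -/

section Bound

variable {k : ℕ} {μ : Measure (Boundary k)} {η : Measure (Boundary k × Boundary k)}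

theorem toWord_mk_take (g : F k) (n : ℕ) :
    (FreeGroup.mk (g.toWord.take n) : F k).toWord = g.toWord.take n := by
  rw [FreeGroup.toWord_mk]
  exact FreeGroup.IsReduced.reduce_eq (List.IsChain.take FreeGroup.isReduced_toWord n)

theorem mem_Cyl_take (g : F k) (n : ℕ) (x : Boundary k) :
    x ∈ Cyl k (FreeGroup.mk (g.toWord.take n)) ↔
      ∀ i (hi : i < g.toWord.length), i < n → x.1 i = g.toWord[i] := by
  simp only [Cyl, Set.mem_ofPred_eq, List.get_eq_getElem, toWord_mk_take, List.getElem_take]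
  constructor
  · intro h i hi hin
    exact h ⟨i, by simp [toWord_mk_take, hi, hin, -FreeGroup.toWord_mk]⟩
  · intro h i
    have hi := i.2
    simp only [toWord_mk_take, List.length_take, lt_inf_iff] at hi
    exact h i hi.2 hi.1

theorem Cyl_subset_Cyl_take (g : F k) (n : ℕ) :
    Cyl k g ⊆ Cyl k (FreeGroup.mk (g.toWord.take n)) := fun x hx =>
  (mem_Cyl_take g n x).2 fun i hi _ => hx ⟨i, hi⟩

/-- If the image of the uniform measure under an equivariant map is not concentrated in a single
direction, then the images of the letters have length bounded in terms of the length of the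
automorphism. -/
theorem exists_wordLength_le (hk : 2 ≤ k) {M : ℝ} (hM : 0 < M) :
    ∃ R : ℕ, ∀ {μ : Measure (Boundary k)} {η : Measure (Boundary k × Boundary k)},
      IsUniform k μ η → ∀ (Ψ : MulAut (F k)) {β : Boundary k → Boundary k}, Measurable β →
      (∀ g x, β (act k g x) = act k (Ψ g) (β x)) →
      (∀ a : L k, μ.real {x | (β x).1 0 = a} ≤ 1 - (4 * k : ℝ)⁻¹) →
      autLen k η β < ENNReal.ofReal M → ∀ s : L k, wordLength k (Ψ (el k s)) ≤ R := by
  have hk' : (2 : ℝ) ≤ k := by exact_mod_cast hk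
  have h3 : (0 : ℝ) < 2 * k - 1 := by linarith
  set c : ℝ := (4 * k : ℝ)⁻¹ with hc
  have hc0 : 0 < c := by positivity
  obtain ⟨R, hR⟩ := exists_card_le (k := k) hk (c := c / (2 * k - 1) * c) (by positivity) hM
  refine ⟨R, fun {μ η} h Ψ β hβm hβ hbal hlen s => ?_⟩
  have := h.prob
  set g := Ψ (el k s) with hg
  set D : Set (Boundary k × Boundary k) := pairMap k β ⁻¹' baseBall k with hD
  have hDfin : η D < ⊤ := hlen.trans ENNReal.ofReal_lt_top
  have : IsFiniteMeasure (η.restrict D) := ⟨by simpa using hDfin⟩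
  let v : Fin g.toWord.length → F k := fun i => FreeGroup.mk (g.toWord.take (i + 1))
  have hv : ∀ i, (v i).toWord = g.toWord.take i ++ [g.toWord[i]] := fun i =>
    (toWord_mk_take g _).trans (List.take_succ_eq_append_getElem i.2)
  let f : Fin g.toWord.length → F k := fun i => Ψ.symm (v i)
  let E : Fin g.toWord.length → Set (Boundary k) := fun i => β ⁻¹' Cyl k (v i)
  have hE : ∀ i, MeasurableSet (E i) := fun i => hβm (measurableSet_Cyl _)
  let Z : Fin g.toWord.length → Set (Boundary k × Boundary k) :=
    fun i => baseBall k ∩ E i ×ˢ (E i)ᶜ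
  have hZ : ∀ i, MeasurableSet (Z i) := fun i =>
    IsUniform.measurableSet_baseBall.inter ((hE i).prod (hE i).compl)
  let Y : Fin g.toWord.length → Set (Boundary k × Boundary k) := fun i => actPair k (f i) ⁻¹' Z i
  have hact : ∀ g : F k, Measurable (actPair k g) := fun g =>
    ((measurable_act g).comp measurable_fst).prodMk ((measurable_act g).comp measurable_snd)
  have hY : ∀ i, MeasurableSet (Y i) := fun i => hact _ (hZ i)
  have hYD : ∀ i, Y i ⊆ D := by
    rintro i ⟨p, q⟩ ⟨-, hp, hq⟩
    simp only [E, actPair, Set.mem_compl_iff, Set.mem_preimage, hβ, f, MulEquiv.apply_symm_apply,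
      mem_Cyl_iff_strip (hv i), act_inv_act, not_not] at hp hq
    rw [hD, Set.mem_preimage, IsUniform.mem_baseBall]
    exact fun hpq => hp (hpq.trans hq)
  have hinter : ∀ i j, η (Y i ∩ Y j) ≤
      ENNReal.ofReal (2 / (2 * k - 1) ^ wordLength k (f i * (f j)⁻¹)) := by
    intro i j
    refine le_trans ?_ (h.baseBall_inter_le (f i * (f j)⁻¹))
    rw [← h.current.2.1 (f i) _ (IsUniform.measurableSet_baseBall.inter
      (hact _ IsUniform.measurableSet_baseBall))]
    refine measure_mono ?_
    rintro ⟨p, q⟩ ⟨⟨hi, -⟩, ⟨hj, -⟩⟩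
    refine ⟨hi, ?_⟩
    simpa [actPair, act_mul] using hj
  have hupper : ∀ i, μ.real (E i) ≤ 1 - c := by
    intro i
    refine le_trans (measureReal_mono fun x hx => ?_)
      (hbal (g.toWord[0]'(Nat.zero_lt_of_lt i.2)))
    exact (mem_Cyl_take g _ _).1 hx 0 _ (Nat.succ_pos _)
  have hlower : ∀ i, c / (2 * k - 1) ≤ μ.real (E i) := by
    intro i
    obtain ⟨w, a, hw⟩ : ∃ w a, g.toWord = w ++ [a] :=
      ⟨_, _, (List.dropLast_append_getLast (List.ne_nil_of_length_pos
        (Nat.zero_lt_of_lt i.2))).symm⟩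
    have h1 := h.real_preimage_el_le s (hβm (measurableSet_Cyl g))
    have h2 : act k (el k s) ⁻¹' (β ⁻¹' Cyl k g) = {x | (β x).1 0 = linv k a}ᶜ := by
      ext x
      simp only [Set.mem_preimage, hβ, mem_Cyl_iff_strip hw, ← hg, act_inv_act]
      rfl
    have h5 : μ.real {x | (β x).1 0 = linv k a}ᶜ = 1 - μ.real {x | (β x).1 0 = linv k a} :=
      probReal_compl_eq_one_sub (hβm (measurableSet_letter 0 _))
    rw [h2, h5] at h1
    have h4 : μ.real (β ⁻¹' Cyl k g) ≤ μ.real (E i) :=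
      measureReal_mono (Set.preimage_mono (Cyl_subset_Cyl_take g _))
    rw [div_le_iff₀ h3]
    nlinarith [hbal (linv k a)]
  refine hR (η.restrict D) g.toWord.length Y f ?_ ?_ hY ?_ ?_
  · rw [measureReal_restrict_apply_univ]
    exact ENNReal.toReal_le_of_le_ofReal hM.le hlen.le
  · intro i j hij
    have h1 : v i = v j := Ψ.symm.injective hij
    have h2 := congrArg (fun u : F k => u.toWord.length) h1
    simp only [v, toWord_mk_take, List.length_take] at h2
    ext
    omega
  · intro i
    rw [measureReal_restrict_apply (hY i), Set.inter_eq_left.2 (hYD i), measureReal_def,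
      h.current.2.1 _ _ (hZ i)]
    have hfin : η (Z i) ≠ ⊤ := by
      rw [← h.current.2.1 (f i) _ (hZ i)]
      exact ((measure_mono (hYD i)).trans_lt hDfin).ne
    refine le_trans ?_ ((ENNReal.ofReal_le_iff_le_toReal hfin).1
      (h.le_baseBall_inter_prod_compl (hE i)))
    exact mul_le_mul (hlower i) (by linarith [hupper i]) hc0.le measureReal_nonneg
  · intro i j
    refine ENNReal.toReal_le_of_le_ofReal (by positivity) ?_
    exact (Measure.restrict_apply_le D _).trans (hinter i j)

/-- The classes of automorphisms of bounded length have representatives that map the basis to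
words of bounded length. -/
theorem exists_conj_wordLength_le (hk : 2 ≤ k) {M : ℝ} (hM : 0 < M) :
    ∃ R : ℕ, ∀ {μ : Measure (Boundary k)} {η : Measure (Boundary k × Boundary k)},
      IsUniform k μ η → ∀ (Φ : MulAut (F k)) {b : Boundary k → Boundary k}, IsBdryExt k Φ b →
      autLen k η b < ENNReal.ofReal M →
        ∃ m : F k, ∀ i, wordLength k ((MulAut.conj m * Φ) (FreeGroup.of i)) ≤ R := by
  obtain ⟨R, hR⟩ := exists_wordLength_le hk hM
  refine ⟨R, fun {μ η} h Φ b hb hlen => ?_⟩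
  obtain ⟨m, hm⟩ := h.exists_balanced Φ hb.measurable hb.act
  refine ⟨m⁻¹, fun i => ?_⟩
  refine hR h (MulAut.conj m⁻¹ * Φ) ((measurable_act m⁻¹).comp hb.measurable) ?_ hm ?_ (i, true)
  · intro g x
    simp [hb.act, act_mul]
  · refine lt_of_eq_of_lt ?_ hlen
    have hpm : Measurable (pairMap k b) :=
      (hb.measurable.comp measurable_fst).prodMk (hb.measurable.comp measurable_snd)
    rw [autLen, autLen, ← h.current.2.1 (Φ.symm m⁻¹) _ (hpm IsUniform.measurableSet_baseBall)]
    congr 1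
    ext ⟨p, q⟩
    simp [pairMap, actPair, hb.act]

theorem mk_conj_mul (m : F k) (Φ : MulAut (F k)) :
    (QuotientGroup.mk (MulAut.conj m * Φ) : OutQ k) = QuotientGroup.mk Φ := by
  rw [eq_comm, QuotientGroup.eq]
  refine ⟨Φ.symm m, ?_⟩
  ext x : 1
  simp [MulAut.inv_def]

theorem exists_conj_mul_eq {Φ Ψ : MulAut (F k)}
    (h : (QuotientGroup.mk Φ : OutQ k) = QuotientGroup.mk Ψ) :
    ∃ m : F k, MulAut.conj m * Φ = Ψ := by
  obtain ⟨v, hv⟩ := QuotientGroup.eq.1 h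
  refine ⟨Φ v, ?_⟩
  have : Ψ = Φ * MulAut.conj v := by rw [hv]; group
  rw [this]
  ext x : 1
  simp

theorem finite_mulAut_wordLength_le (R : ℕ) :
    {Ψ : MulAut (F k) | ∀ i, wordLength k (Ψ (FreeGroup.of i)) ≤ R}.Finite := by
  have hfin : {u : Fin k → F k | ∀ i, u i ∈ {g : F k | wordLength k g < R + 1}}.Finite :=
    Set.Finite.pi' fun _ => finite_wordLength_lt (R + 1)
  refine Set.Finite.of_finite_image (f := fun Ψ i => Ψ (FreeGroup.of i))
    (hfin.subset ?_) ?_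
  · rintro _ ⟨Ψ, hΨ, rfl⟩ i
    exact Nat.lt_succ_of_le (hΨ i)
  · intro Ψ _ Ψ' _ hΨ
    apply MulEquiv.toMonoidHom_injective
    ext i
    exact congrFun hΨ i

/-- There are only finitely many outer classes of automorphisms of bounded length. -/
theorem IsUniform.finite_image (h : IsUniform k μ η) {bd : MulAut (F k) → Boundary k → Boundary k}
    (hbd : ∀ Φ : MulAut (F k), IsBdryExt k Φ (bd Φ)) (M : ℝ) :
    Set.Finite ((QuotientGroup.mk : MulAut (F k) → OutQ k) ''
        { Φ : MulAut (F k) | autLen k η (bd Φ) < ENNReal.ofReal M }) := by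
  rcases le_or_gt M 0 with hM | hM
  · simp [ENNReal.ofReal_of_nonpos hM]
  obtain ⟨R, hR⟩ := exists_conj_wordLength_le h.two_le hM
  refine ((finite_mulAut_wordLength_le R).image (QuotientGroup.mk : MulAut (F k) → OutQ k)).subset ?_
  rintro _ ⟨Φ, hΦ, rfl⟩
  obtain ⟨m, hm⟩ := hR h Φ (hbd Φ) hΦ
  exact ⟨_, hm, mk_conj_mul m Φ⟩

end Bound

theorem length_compactness (k : ℕ) (hk : 2 ≤ k)
    (μA : Measure (Boundary k)) [IsProbabilityMeasure μA]
    (hμA : ∀ v : F k, v ≠ 1 →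
      μA (Cyl k v) = ((2 * k : ℝ≥0∞) * (2 * k - 1) ^ (wordLength k v - 1))⁻¹)
    (ηA : Measure (Boundary k × Boundary k)) (hηA : IsCurrent k ηA)
    (hηA' : ∀ x y : F k, ηA (Cyl2 k x y) = μA (Cyl k (x⁻¹ * y)))
    (bd : MulAut (F k) → Boundary k → Boundary k)
    (hbd : ∀ Φ : MulAut (F k), IsBdryExt k Φ (bd Φ)) :
    (∀ M : ℝ, Set.Finite ((QuotientGroup.mk : MulAut (F k) → OutQ k) ''
        { Φ : MulAut (F k) | autLen k ηA (bd Φ) < ENNReal.ofReal M })) ∧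
    ∀ Φ : ℕ → MulAut (F k), ∃ ι : ℕ → ℕ, StrictMono ι ∧ ∃ v : ℕ → F k,
      Xor' (∀ i j : ℕ, MulAut.conj (v i) * Φ (ι i) = MulAut.conj (v j) * Φ (ι j))
        (Tendsto (fun n => autLen k ηA (bd (Φ n))) atTop (𝓝 (⊤ : ℝ≥0∞))) := by
  have h : IsUniform k μA ηA := ⟨hk, inferInstance, hμA, hηA, hηA'⟩
  refine ⟨h.finite_image hbd, fun Φ => ?_⟩
  by_cases hΦ : Tendsto (fun n => autLen k ηA (bd (Φ n))) atTop (𝓝 (⊤ : ℝ≥0∞))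
  · refine ⟨id, strictMono_id, ?_⟩
    obtain ⟨m, hm⟩ : ∃ m : F k, MulAut.conj m * Φ 1 ≠ Φ 0 := by
      by_contra! hcon
      have h1 := (hcon (FreeGroup.of ⟨0, by omega⟩)).trans (hcon 1).symm
      rw [mul_left_inj] at h1
      have h2 := DFunLike.congr_fun h1 (FreeGroup.of ⟨1, by omega⟩)
      rw [map_one, MulAut.one_apply, MulAut.conj_apply, mul_inv_eq_iff_eq_mul] at h2
      have h3 := congrArg FreeGroup.toWord h2
      simp [FreeGroup.toWord_mul, FreeGroup.reduce.cons, FreeGroup.toWord_of] at h3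
    refine ⟨fun n => if n = 0 then 1 else m, Or.inr ⟨hΦ, fun hcon => hm ?_⟩⟩
    simpa using (hcon 0 1).symm
  · obtain ⟨M, hM⟩ : ∃ M : ℝ, ∃ᶠ n in atTop, autLen k ηA (bd (Φ n)) < ENNReal.ofReal M := by
      rw [ENNReal.tendsto_nhds_top_iff_nnreal] at hΦ
      push Not at hΦ
      obtain ⟨x, hx⟩ := hΦ
      refine ⟨x + 1, hx.mono fun n hn => hn.trans_lt ?_⟩
      rw [← ENNReal.ofReal_coe_nnreal]
      exact (ENNReal.ofReal_lt_ofReal_iff (by positivity)).2 (by linarith)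
    obtain ⟨C, -, hC⟩ : ∃ C ∈ (QuotientGroup.mk : MulAut (F k) → OutQ k) ''
        {Φ : MulAut (F k) | autLen k ηA (bd Φ) < ENNReal.ofReal M},
        ∃ᶠ n in atTop, (QuotientGroup.mk (Φ n) : OutQ k) = C := by
      by_contra! hcon
      have hall := (Filter.eventually_all_finite (h.finite_image hbd M)).2
        hcon
      obtain ⟨n, hn, hn'⟩ := (hM.and_eventually hall).exists
      exact hn' _ ⟨Φ n, hn, rfl⟩ rfl
    obtain ⟨ι, hι, hιC⟩ := extraction_of_frequently_atTop hC
    choose v hv using fun i => exists_conj_mul_eq ((hιC i).trans (hιC 0).symm)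
    exact ⟨ι, hι, v, Or.inl ⟨fun i j => (hv i).trans (hv j).symm, hΦ⟩⟩

end

end FGC
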